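/- arXiv:0710.5674 — 2 statements merged into one kernel-verified Lean document; each statement's English description precedes it below -/
import Mathlib

section
/- The rewrite system R_DSKS is convergent, i.e. terminating and confluent, and it generates the equational theory H_DSKS: two terms are equal modulo H_DSKS if and only if they have the same R_DSKS-normal form. -/
set_option maxHeartbeats 1000000

namespace Paper

/-- First-order terms over a signature `Sg` with arities `ar`, with free
constants (indexed by `ℕ`) and variables (indexed by `ℕ`). -/
inductive Tm (Sg : Type) (ar : Sg → ℕ) : Type where
  | var : ℕ → Tm Sg ar
  | cst : ℕ → Tm Sg ar
  | app : (s : Sg) → (Fin (ar s) → Tm Sg ar) → Tm Sg ar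

variable {Sg : Type} {ar : Sg → ℕ}

/-- Substitutions. -/
abbrev Subst (Sg : Type) (ar : Sg → ℕ) := ℕ → Tm Sg ar

/-- Application of a substitution to a term. -/
def subst (σ : Subst Sg ar) : Tm Sg ar → Tm Sg ar
  | .var n => σ n
  | .cst c => .cst c
  | .app s a => .app s (fun i => subst σ (a i))

/-- Composition of substitutions: `scomp τ σ` first applies `σ`, then `τ`. -/
def scomp (τ σ : Subst Sg ar) : Subst Sg ar := fun n => subst τ (σ n)

def isVar : Tm Sg ar → Prop
  | .var _ => True
  | _ => False

def isVarB : Tm Sg ar → Bool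
  | .var _ => true
  | _ => false

/-- The set of variables of a term. -/
def vars : Tm Sg ar → Set ℕ
  | .var n => {n}
  | .cst _ => ∅
  | .app _ a => ⋃ i, vars (a i)

/-- A term is ground if it has no variables. -/
def Ground (t : Tm Sg ar) : Prop := vars t = ∅

/-- The subterm of `t` at position `p` (a sequence of argument indices). -/
def subtermAt : Tm Sg ar → List ℕ → Option (Tm Sg ar)
  | t, [] => some t
  | .var _, _ :: _ => none
  | .cst _, _ :: _ => none
  | .app s a, i :: p => if h : i < ar s then subtermAt (a ⟨i, h⟩) p else none

/-- Replacement of the subterm at position `p` by `u`. -/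
def replaceAt : Tm Sg ar → List ℕ → Tm Sg ar → Tm Sg ar
  | _, [], u => u
  | .var n, _ :: _, _ => .var n
  | .cst c, _ :: _, _ => .cst c
  | .app s a, i :: p, u => .app s (fun j => if j.1 = i then replaceAt (a j) p u else a j)

/-- The set of subterms of a term. -/
def subterms (t : Tm Sg ar) : Set (Tm Sg ar) := {u | ∃ p, subtermAt t p = some u}

/-- The number of symbols of a term. -/
def tmSize : Tm Sg ar → ℕ
  | .var _ => 1
  | .cst _ => 1
  | .app _ a => 1 + Finset.univ.sum (fun i => tmSize (a i))

/-- One-step rewriting with the rules `R` (closed under substitution and contexts). -/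
inductive Rew (R : Tm Sg ar → Tm Sg ar → Prop) : Tm Sg ar → Tm Sg ar → Prop where
  | root : ∀ (l r : Tm Sg ar) (σ : Subst Sg ar), R l r → Rew R (subst σ l) (subst σ r)
  | congr : ∀ (s : Sg) (a b : Fin (ar s) → Tm Sg ar) (i : Fin (ar s)),
      Rew R (a i) (b i) → (∀ j, j ≠ i → a j = b j) → Rew R (Tm.app s a) (Tm.app s b)

/-- The reflexive-transitive closure of rewriting. -/
def Reduces (R : Tm Sg ar → Tm Sg ar → Prop) : Tm Sg ar → Tm Sg ar → Prop :=
  Relation.ReflTransGen (Rew R)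

/-- A term is in normal form if no rewriting step applies to it. -/
def NormalForm (R : Tm Sg ar → Tm Sg ar → Prop) (t : Tm Sg ar) : Prop := ∀ u, ¬ Rew R t u

/-- A substitution is in normal form if all its images are. -/
def NormalSubst (R : Tm Sg ar → Tm Sg ar → Prop) (σ : Subst Sg ar) : Prop :=
  ∀ n, NormalForm R (σ n)

/-- Termination of rewriting: no infinite rewriting sequences. -/
def Terminating (R : Tm Sg ar → Tm Sg ar → Prop) : Prop :=
  WellFounded (fun a b : Tm Sg ar => Rew R b a)

/-- Confluence of rewriting. -/
def Confluent (R : Tm Sg ar → Tm Sg ar → Prop) : Prop :=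
  ∀ a b c : Tm Sg ar, Reduces R a b → Reduces R a c →
    ∃ d, Reduces R b d ∧ Reduces R c d

/-- Convergence: termination together with confluence. -/
def Convergent (R : Tm Sg ar → Tm Sg ar → Prop) : Prop := Terminating R ∧ Confluent R

/-- The equational theory generated by a set of axioms `A`: the smallest
congruence containing all substitution instances of the axioms. -/
inductive EqTh (A : Tm Sg ar → Tm Sg ar → Prop) : Tm Sg ar → Tm Sg ar → Prop where
  | ax : ∀ (l r : Tm Sg ar) (σ : Subst Sg ar), A l r → EqTh A (subst σ l) (subst σ r)
  | refl : ∀ t, EqTh A t t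
  | symm : ∀ {t u}, EqTh A t u → EqTh A u t
  | trans : ∀ {t u v}, EqTh A t u → EqTh A u v → EqTh A t v
  | congr : ∀ (s : Sg) (a b : Fin (ar s) → Tm Sg ar),
      (∀ i, EqTh A (a i) (b i)) → EqTh A (Tm.app s a) (Tm.app s b)

/-- `σ` unifies `u` and `v` syntactically. -/
def Unifies (σ : Subst Sg ar) (u v : Tm Sg ar) : Prop := subst σ u = subst σ v

/-- `σ` is a most general (syntactic) unifier of `u` and `v`. -/
def IsMGU (σ : Subst Sg ar) (u v : Tm Sg ar) : Prop :=
  Unifies σ u v ∧ ∀ τ, Unifies τ u v → ∃ ρ, ∀ n, τ n = subst ρ (σ n)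

def UnifiesSys (σ : Subst Sg ar) (S : List (Tm Sg ar × Tm Sg ar)) : Prop :=
  ∀ e ∈ S, subst σ e.1 = subst σ e.2

/-- `σ` is a most general (syntactic) unifier of the system `S`. -/
def IsMGUSys (σ : Subst Sg ar) (S : List (Tm Sg ar × Tm Sg ar)) : Prop :=
  UnifiesSys σ S ∧ ∀ τ, UnifiesSys τ S → ∃ ρ, ∀ n, τ n = subst ρ (σ n)

/-- `σ` is an `H`-unifier (modulo the theory generated by `A`) of the system `S`. -/
def HUnifier (A : Tm Sg ar → Tm Sg ar → Prop) (σ : Subst Sg ar)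
    (S : List (Tm Sg ar × Tm Sg ar)) : Prop :=
  ∀ e ∈ S, EqTh A (subst σ e.1) (subst σ e.2)

/-- Narrowing: `t ⤳ t'` with substitution `σ`, using a rule `l → r` of `R` at a
non-variable position `p` of `t`, where `σ = mgu(t|_p, l)`. -/
def Narrow (R : Tm Sg ar → Tm Sg ar → Prop) (t : Tm Sg ar) (σ : Subst Sg ar)
    (t' : Tm Sg ar) : Prop :=
  ∃ l r p u, R l r ∧ subtermAt t p = some u ∧ ¬ isVar u ∧ IsMGU σ u l ∧
    t' = replaceAt (subst σ t) p (subst σ r)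

/-- The non-variable positions of a term. -/
def nonVarPos (t : Tm Sg ar) : Set (List ℕ) :=
  {p | ∃ u, subtermAt t p = some u ∧ ¬ isVar u}

/-- A configuration for basic narrowing: a term with its set of basic positions. -/
abbrev Conf (Sg : Type) (ar : Sg → ℕ) := Tm Sg ar × Set (List ℕ)

/-- One basic narrowing step: narrowing at a basic position; the basic positions
of the result are those of the source not below the redex position `p`,
together with `p·q` for `q` a non-variable position of the right-hand side. -/
def BNStep (R : Tm Sg ar → Tm Sg ar → Prop) (c : Conf Sg ar) (σ : Subst Sg ar)
    (c' : Conf Sg ar) : Prop :=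
  ∃ l r p u, R l r ∧ p ∈ c.2 ∧ subtermAt c.1 p = some u ∧ ¬ isVar u ∧ IsMGU σ u l ∧
    c'.1 = replaceAt (subst σ c.1) p (subst σ r) ∧
    c'.2 = {q | q ∈ c.2 ∧ ¬ (p <+: q)} ∪ {q | ∃ q', q = p ++ q' ∧ q' ∈ nonVarPos r}

/-- Sequences of basic narrowing steps, recording the composed substitution. -/
inductive BN (R : Tm Sg ar → Tm Sg ar → Prop) : Conf Sg ar → Subst Sg ar → Conf Sg ar → Prop where
  | refl : ∀ c, BN R c Tm.var c
  | step : ∀ {c c' c'' : Conf Sg ar} {σ θ : Subst Sg ar},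
      BNStep R c σ c' → BN R c' θ c'' → BN R c (scomp θ σ) c''

/-- Basic narrowing between terms, starting with all non-variable positions basic. -/
def BNTerms (R : Tm Sg ar → Tm Sg ar → Prop) (t : Tm Sg ar) (σ : Subst Sg ar)
    (t' : Tm Sg ar) : Prop :=
  ∃ B, BN R (t, nonVarPos t) σ (t', B)

/-! ### Intruder deduction systems -/

/-- An intruder deduction rule `l ↠ r`: a set of premises and a conclusion. -/
abbrev Rule (Sg : Type) (ar : Sg → ℕ) := Set (Tm Sg ar) × Tm Sg ar

/-- One deduction step modulo the equational theory generated by `A`. -/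
def DedStep (L : Set (Rule Sg ar)) (A : Tm Sg ar → Tm Sg ar → Prop)
    (E F : Set (Tm Sg ar)) : Prop :=
  ∃ l r σ r', (l, r) ∈ L ∧ (∀ u ∈ l, ∃ u' ∈ E, EqTh A (subst σ u) u') ∧
    EqTh A (subst σ r) r' ∧ F = E ∪ {r'}

/-- `t` is derivable from `E` modulo `A`. -/
def Deriv (L : Set (Rule Sg ar)) (A : Tm Sg ar → Tm Sg ar → Prop)
    (E : Set (Tm Sg ar)) (t : Tm Sg ar) : Prop :=
  ∃ F, Relation.ReflTransGen (DedStep L A) E F ∧ t ∈ F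

/-- One deduction step modulo the empty equational theory. -/
def DedStepSyn (L : Set (Rule Sg ar)) (E F : Set (Tm Sg ar)) : Prop :=
  ∃ l r σ, (l, r) ∈ L ∧ (∀ u ∈ l, subst σ u ∈ E) ∧ F = E ∪ {subst σ r}

/-- `t` is derivable from `E` modulo the empty theory. -/
def DerivSyn (L : Set (Rule Sg ar)) (E : Set (Tm Sg ar)) (t : Tm Sg ar) : Prop :=
  ∃ F, Relation.ReflTransGen (DedStepSyn L) E F ∧ t ∈ F

/-! ### Constraint systems -/

/-- A constraint system with variable right-hand sides: a sequence of pairs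
`(E_i, v_i)` of a finite knowledge set and a variable. -/
abbrev CSys (Sg : Type) (ar : Sg → ℕ) := List (List (Tm Sg ar) × ℕ)

/-- A general (extended) constraint system: deduction constraints `E_i ▷ t_i`. -/
abbrev GCS (Sg : Type) (ar : Sg → ℕ) := List (List (Tm Sg ar) × Tm Sg ar)

/-- The set of instances by `σ` of the members of `E`. -/
def substList (σ : Subst Sg ar) (E : List (Tm Sg ar)) : Set (Tm Sg ar) :=
  {u | ∃ e ∈ E, u = subst σ e}

/-- Well-formedness of a constraint system `((E_i ▷ v_i))_i`: knowledge
monotonicity and origination of variables. -/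
def WFC (C : CSys Sg ar) : Prop :=
  (∀ i j (hi : i < C.length) (hj : j < C.length), i ≤ j →
     ∀ u ∈ (C.get ⟨i, hi⟩).1, u ∈ (C.get ⟨j, hj⟩).1) ∧
  (∀ i (hi : i < C.length), ∀ u ∈ (C.get ⟨i, hi⟩).1, ∀ x ∈ vars u,
     ∃ j, ∃ hj : j < C.length, j < i ∧ (C.get ⟨j, hj⟩).2 = x)

/-- Well-formedness of a general constraint system `((E_i ▷ t_i))_i`. -/
def WFG (C : GCS Sg ar) : Prop :=
  (∀ i j (hi : i < C.length) (hj : j < C.length), i ≤ j →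
     ∀ u ∈ (C.get ⟨i, hi⟩).1, u ∈ (C.get ⟨j, hj⟩).1) ∧
  (∀ i (hi : i < C.length), ∀ u ∈ (C.get ⟨i, hi⟩).1, ∀ x ∈ vars u,
     ∃ j, ∃ hj : j < C.length, j < i ∧ (C.get ⟨j, hj⟩).2 = Tm.var x)

/-- `σ` satisfies the constraint system `(C, S)` in the intruder system given by
deduction rules `L` modulo the theory generated by `A`. -/
def SatC (L : Set (Rule Sg ar)) (A : Tm Sg ar → Tm Sg ar → Prop)
    (σ : Subst Sg ar) (C : CSys Sg ar) (S : List (Tm Sg ar × Tm Sg ar)) : Prop :=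
  (∀ p ∈ C, Deriv L A (substList σ p.1) (σ p.2)) ∧ HUnifier A σ S

/-- `σ` satisfies the deduction constraints of `C` modulo `A`. -/
def SatG (L : Set (Rule Sg ar)) (A : Tm Sg ar → Tm Sg ar → Prop)
    (σ : Subst Sg ar) (C : GCS Sg ar) : Prop :=
  ∀ p ∈ C, Deriv L A (substList σ p.1) (subst σ p.2)

/-- `σ` satisfies the deduction constraints of `C` modulo the empty theory. -/
def SatGSyn (L : Set (Rule Sg ar)) (σ : Subst Sg ar) (C : GCS Sg ar) : Prop :=
  ∀ p ∈ C, DerivSyn L (substList σ p.1) (subst σ p.2)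

/-- A general constraint system is in solved form when every right-hand side is
a variable. -/
def SolvedForm (C : GCS Sg ar) : Prop := ∀ p ∈ C, isVar p.2

/-- Viewing a constraint system with variable right-hand sides as a general one. -/
def toGCS (C : CSys Sg ar) : GCS Sg ar := C.map (fun p => (p.1, Tm.var p.2))

/-- Componentwise basic narrowing of lists of terms. -/
def ListNarrow (R : Tm Sg ar → Tm Sg ar → Prop) (E E' : List (Tm Sg ar)) : Prop :=
  E.length = E'.length ∧
  ∀ i (h : i < E.length) (h' : i < E'.length),
    ∃ μ, BNTerms R (E.get ⟨i, h⟩) μ (E'.get ⟨i, h'⟩)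

/-- `C'` is obtained from `C` by applying basic narrowing steps to the
subterms of `C`. -/
def CNarrow (R : Tm Sg ar → Tm Sg ar → Prop) (C C' : GCS Sg ar) : Prop :=
  C.length = C'.length ∧
  ∀ i (h : i < C.length) (h' : i < C'.length),
    ListNarrow R (C.get ⟨i, h⟩).1 (C'.get ⟨i, h'⟩).1 ∧
    ∃ μ, BNTerms R (C.get ⟨i, h⟩).2 μ (C'.get ⟨i, h'⟩).2

/-! ### Saturation -/

/-- Rule `ρ` is subsumed by a rule of `L`. -/
def Subsumed (L : Set (Rule Sg ar)) (ρ : Rule Sg ar) : Prop :=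
  ∃ l1, (l1, ρ.2) ∈ L ∧ l1 ⊆ ρ.1

/-- One narrowing step on a deduction rule `(l, r)`, performed on the
conclusion or on one of the premises, instantiating the rest. -/
def RuleNarrow (R : Tm Sg ar → Tm Sg ar → Prop) (ρ ρ' : Rule Sg ar) : Prop :=
  (∃ σ r', Narrow R ρ.2 σ r' ∧ ρ' = ((subst σ) '' ρ.1, r')) ∨
  (∃ u ∈ ρ.1, ∃ σ u', Narrow R u σ u' ∧
      ρ' = (insert u' ((subst σ) '' (ρ.1 \ {u})), subst σ ρ.2))

/-- The saturation rules of Figure 1: Subsumption, Closure and Narrow. -/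
inductive SatStep (R : Tm Sg ar → Tm Sg ar → Prop) :
    Set (Rule Sg ar) → Set (Rule Sg ar) → Prop where
  | subsum : ∀ {L : Set (Rule Sg ar)} {l1 l2 : Set (Tm Sg ar)} {r : Tm Sg ar},
      (l1, r) ∈ L → (l2, r) ∈ L → l1 ⊆ l2 → l1 ≠ l2 → SatStep R L (L \ {(l2, r)})
  | closure : ∀ {L : Set (Rule Sg ar)} {l1 l2 : Set (Tm Sg ar)}
      {r1 t r2 : Tm Sg ar} {σ : Subst Sg ar},
      (l1, r1) ∈ L → (insert t l2, r2) ∈ L → ¬ isVar t → IsMGU σ r1 t →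
      SatStep R L (insert ((subst σ) '' (l1 ∪ l2), subst σ r2) L)
  | narrow : ∀ {L : Set (Rule Sg ar)} {ρ ρ' : Rule Sg ar},
      ρ ∈ L → RuleNarrow R ρ ρ' → SatStep R L (insert ρ' L)

/-- `L` is saturated: every rule produced by Closure or Narrow is subsumed. -/
def Saturated (R : Tm Sg ar → Tm Sg ar → Prop) (L : Set (Rule Sg ar)) : Prop :=
  (∀ (l1 l2 : Set (Tm Sg ar)) (r1 t r2 : Tm Sg ar) (σ : Subst Sg ar),
     (l1, r1) ∈ L → (insert t l2, r2) ∈ L → ¬ isVar t → IsMGU σ r1 t →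
     Subsumed L ((subst σ) '' (l1 ∪ l2), subst σ r2)) ∧
  (∀ ρ ∈ L, ∀ ρ', RuleNarrow R ρ ρ' → Subsumed L ρ')

/-! ### Transformation rules on constraint systems (Figure 2) -/

/-- Instantiation of a constraint system. -/
def csubst (σ : Subst Sg ar) (C : GCS Sg ar) : GCS Sg ar :=
  C.map (fun p => (p.1.map (subst σ), subst σ p.2))

/-- The transformation rules `Unif` and `Apply` of Figure 2, applied to the
first deduction constraint whose right-hand side is not a variable. -/
inductive TStep (L' : Set (Rule Sg ar)) : GCS Sg ar → GCS Sg ar → Prop where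
  | unif : ∀ {Cα Cβ : GCS Sg ar} {E : List (Tm Sg ar)} {t u : Tm Sg ar} {σ : Subst Sg ar},
      SolvedForm Cα → ¬ isVar t → u ∈ E → ¬ isVar u → IsMGU σ u t →
      TStep L' (Cα ++ (E, t) :: Cβ) (csubst σ (Cα ++ Cβ))
  | apply : ∀ {Cα Cβ : GCS Sg ar} {E : List (Tm Sg ar)} {t r : Tm Sg ar}
      {l : Set (Tm Sg ar)} {lx lnl el : List (Tm Sg ar)} {σ : Subst Sg ar},
      SolvedForm Cα → ¬ isVar t → (l, r) ∈ L' →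
      (∀ u ∈ lx, isVar u) → (∀ u, u ∈ l ↔ (u ∈ lx ∨ u ∈ lnl)) →
      el.length = lnl.length → (∀ e ∈ el, e ∈ E) →
      IsMGUSys σ ((el.zip lnl) ++ [(r, t)]) →
      TStep L' (Cα ++ (E, t) :: Cβ)
        (csubst σ (Cα ++ (lx.map (fun y => (E, y))) ++ Cβ))

/-! ### Narrowing of unification systems (for Hullot's procedure) -/

/-- An equation between two basic-narrowing configurations. -/
abbrev EqConf (Sg : Type) (ar : Sg → ℕ) := Conf Sg ar × Conf Sg ar

def csub (σ : Subst Sg ar) (e : EqConf Sg ar) : EqConf Sg ar :=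
  ((subst σ e.1.1, e.1.2), (subst σ e.2.1, e.2.2))

/-- One basic narrowing step on one side of one equation of the system, the
substitution being applied to the whole system. -/
def SysBNStep (R : Tm Sg ar → Tm Sg ar → Prop) (c : List (EqConf Sg ar))
    (σ : Subst Sg ar) (c' : List (EqConf Sg ar)) : Prop :=
  ∃ (i : Fin c.length) (side : Bool) (d : Conf Sg ar),
    BNStep R (if side then (c.get i).1 else (c.get i).2) σ d ∧
    c' = (c.map (csub σ)).set i.1
      (if side then (d, (csub σ (c.get i)).2) else ((csub σ (c.get i)).1, d))

/-- Sequences of basic narrowing steps on a unification system, recording the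
composed substitution. -/
inductive SysBN (R : Tm Sg ar → Tm Sg ar → Prop) :
    List (EqConf Sg ar) → Subst Sg ar → List (EqConf Sg ar) → Prop where
  | refl : ∀ c, SysBN R c Tm.var c
  | step : ∀ {c c' c'' : List (EqConf Sg ar)} {σ θ : Subst Sg ar},
      SysBNStep R c σ c' → SysBN R c' θ c'' → SysBN R c (scomp θ σ) c''

/-- The initial configuration of a unification system: all non-variable
positions are basic. -/
def initConf (S : List (Tm Sg ar × Tm Sg ar)) : List (EqConf Sg ar) :=
  S.map (fun e => ((e.1, nonVarPos e.1), (e.2, nonVarPos e.2)))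

/-- The substitutions output by Hullot's procedure on the system `S`: a basic
narrowing derivation followed by syntactic unification of the resulting system. -/
def ProcOutput (R : Tm Sg ar → Tm Sg ar → Prop) (S : List (Tm Sg ar × Tm Sg ar))
    (δ : Subst Sg ar) : Prop :=
  ∃ c' σ τ, SysBN R (initConf S) σ c' ∧
    IsMGUSys τ (c'.map (fun e => (e.1.1, e.2.1))) ∧ δ = scomp τ σ

/-- The size of a unification system. -/
def sysSize (S : List (Tm Sg ar × Tm Sg ar)) : ℕ :=
  (S.map (fun e => tmSize e.1 + tmSize e.2)).sum

/-- The size of a certificate (a substitution presented as a finite list). -/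
def certSize (c : List (ℕ × Tm Sg ar)) : ℕ := (c.map (fun e => tmSize e.2)).sum

/-! ### The DSKS signature -/

/-- The signature G_DSKS = {Sig, Ver, SK', PK', 0, 1, SK, PK}. -/
inductive SgD : Type | sig | ver | skp | pkp | zero | one | sk | pk

def arD : SgD → ℕ
  | .sig => 2 | .ver => 3 | .skp => 2 | .pkp => 2
  | .zero => 0 | .one => 0 | .sk => 1 | .pk => 1

abbrev TmD := Tm SgD arD

def dSig (a b : TmD) : TmD := .app .sig ![a, b]
def dVer (a b c : TmD) : TmD := .app .ver ![a, b, c]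
def dSkp (a b : TmD) : TmD := .app .skp ![a, b]
def dPkp (a b : TmD) : TmD := .app .pkp ![a, b]
def dSk (a : TmD) : TmD := .app .sk ![a]
def dPk (a : TmD) : TmD := .app .pk ![a]
def dZero : TmD := .app .zero ![]
def dOne : TmD := .app .one ![]

def xD : TmD := .var 0
def yD : TmD := .var 1
def zD : TmD := .var 2
def y1D : TmD := .var 1
def y2D : TmD := .var 2

/-- The convergent rewrite system R_DSKS. -/
inductive RDSKS : TmD → TmD → Prop where
  | r1 : RDSKS (dVer xD (dSig xD (dSk yD)) (dPk yD)) dOne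
  | r2 : RDSKS (dVer xD (dSig xD (dSkp y1D y2D)) (dPkp y1D y2D)) dOne
  | r3 : RDSKS (dVer xD (dSig xD (dSk yD)) (dPkp (dPk yD) (dSig xD (dSk yD)))) dOne
  | r4 : RDSKS (dSig xD (dSkp (dPk yD) (dSig xD (dSk yD)))) (dSig xD (dSk yD))

/-- The axioms A_DSKS presenting the equational theory H_DSKS. -/
inductive ADSKS : TmD → TmD → Prop where
  | a1 : ADSKS (dVer xD (dSig xD (dSk yD)) (dPk yD)) dOne
  | a2 : ADSKS (dVer xD (dSig xD (dSkp y1D y2D)) (dPkp y1D y2D)) dOne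
  | a3 : ADSKS (dSig xD (dSkp (dPk yD) (dSig xD (dSk yD)))) (dSig xD (dSk yD))

/-- The intruder deduction rules L_DSKS. -/
def LDSKS : Set (Rule SgD arD) :=
  { (({xD, yD} : Set TmD), dSig xD yD), (({xD, yD, zD} : Set TmD), dVer xD yD zD),
    (({xD, yD} : Set TmD), dSkp xD yD), (({xD, yD} : Set TmD), dPkp xD yD),
    ((∅ : Set TmD), dZero), ((∅ : Set TmD), dOne) }

/-- The saturated deduction rules L'_DSKS. -/
def LDSKS' : Set (Rule SgD arD) :=
  LDSKS ∪ { (({xD, dSk yD} : Set TmD), dSig xD (dSk yD)),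
            (({xD, dSkp (dPk yD) (dSig xD (dSk yD))} : Set TmD), dSig xD (dSk yD)) }

/-! ### The DEO signature -/

/-- The signature G_DEO = {Sig, Ver, SK'', PK'', f, 0, 1, SK, PK}. -/
inductive SgE : Type | sig | ver | skp | pkp | f | zero | one | sk | pk

def arE : SgE → ℕ
  | .sig => 2 | .ver => 3 | .skp => 2 | .pkp => 2 | .f => 2
  | .zero => 0 | .one => 0 | .sk => 1 | .pk => 1

abbrev TmE := Tm SgE arE

def eSig (a b : TmE) : TmE := .app .sig ![a, b]
def eVer (a b c : TmE) : TmE := .app .ver ![a, b, c]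
def eSkp (a b : TmE) : TmE := .app .skp ![a, b]
def ePkp (a b : TmE) : TmE := .app .pkp ![a, b]
def eF (a b : TmE) : TmE := .app .f ![a, b]
def eSk (a : TmE) : TmE := .app .sk ![a]
def ePk (a : TmE) : TmE := .app .pk ![a]
def eZero : TmE := .app .zero ![]
def eOne : TmE := .app .one ![]

def xE : TmE := .var 0
def yE : TmE := .var 1
def zE : TmE := .var 2
def y1E : TmE := .var 1
def y2E : TmE := .var 2

/-- The convergent rewrite system R_DEO. -/
inductive RDEO : TmE → TmE → Prop where
  | r1 : RDEO (eVer xE (eSig xE (eSk yE)) (ePk yE)) eOne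
  | r2 : RDEO (eVer xE (eSig xE (eSkp y1E y2E)) (ePkp y1E y2E)) eOne
  | r3 : RDEO (eVer (eF (ePk yE) (eSig xE (eSk yE))) (eSig xE (eSk yE))
      (ePkp (ePk yE) (eSig xE (eSk yE)))) eOne
  | r4 : RDEO (eSig (eF (ePk yE) (eSig xE (eSk yE))) (eSkp (ePk yE) (eSig xE (eSk yE))))
      (eSig xE (eSk yE))

/-- The axioms A_DEO presenting the equational theory H_DEO. -/
inductive ADEO : TmE → TmE → Prop where
  | a1 : ADEO (eVer xE (eSig xE (eSk yE)) (ePk yE)) eOne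
  | a2 : ADEO (eVer xE (eSig xE (eSkp y1E y2E)) (ePkp y1E y2E)) eOne
  | a3 : ADEO (eSig (eF (ePk yE) (eSig xE (eSk yE))) (eSkp (ePk yE) (eSig xE (eSk yE))))
      (eSig xE (eSk yE))

/-- The intruder deduction rules L_DEO. -/
def LDEO : Set (Rule SgE arE) :=
  { (({xE, yE} : Set TmE), eSig xE yE), (({xE, yE, zE} : Set TmE), eVer xE yE zE),
    (({xE, yE} : Set TmE), eSkp xE yE), (({xE, yE} : Set TmE), ePkp xE yE),
    (({xE, yE} : Set TmE), eF xE yE),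
    ((∅ : Set TmE), eZero), ((∅ : Set TmE), eOne) }

/-- The saturated deduction rules L'_DEO. -/
def LDEO' : Set (Rule SgE arE) :=
  LDEO ∪ { (({eF (ePk yE) (eSig xE (eSk yE)), eSkp (ePk yE) (eSig xE (eSk yE))} : Set TmE),
            eSig xE (eSk yE)) }


end Paper

namespace Paper

section General

variable {Sg : Type} {ar : Sg → ℕ} {R : Tm Sg ar → Tm Sg ar → Prop}

theorem Rew.app_update (s : Sg) (c : Fin (ar s) → Tm Sg ar) (i : Fin (ar s))
    {t u : Tm Sg ar} (h : Rew R t u) :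
    Rew R (Tm.app s (Function.update c i t)) (Tm.app s (Function.update c i u)) := by
  refine Rew.congr s _ _ i (by simpa using h) fun j hj => ?_
  simp [Function.update_of_ne hj]

theorem Reduces.app_update (s : Sg) (c : Fin (ar s) → Tm Sg ar) (i : Fin (ar s))
    {t u : Tm Sg ar} (h : Reduces R t u) :
    Reduces R (Tm.app s (Function.update c i t)) (Tm.app s (Function.update c i u)) :=
  Relation.ReflTransGen.lift (fun x => Tm.app s (Function.update c i x))
    (fun _ _ => Rew.app_update s c i) _ _ h

/-- Rewriting to a term in finitely many steps is compatible with function symbols. -/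
theorem Reduces.app (s : Sg) {a b : Fin (ar s) → Tm Sg ar}
    (h : ∀ i, Reduces R (a i) (b i)) : Reduces R (Tm.app s a) (Tm.app s b) := by
  classical
  have key : ∀ S : Finset (Fin (ar s)),
      Reduces R (Tm.app s a) (Tm.app s (S.piecewise b a)) := by
    intro S
    induction S using Finset.induction_on with
    | empty => rw [Finset.piecewise_empty]; exact Relation.ReflTransGen.refl
    | insert i S hi ih =>
      refine Relation.ReflTransGen.trans ih ?_
      have step := Reduces.app_update s (S.piecewise b a) i (h i)
      rw [← Finset.piecewise_insert] at step
      have hu : Function.update (S.piecewise b a) i (a i) = S.piecewise b a := by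
        rw [Function.update_eq_self_iff, Finset.piecewise_eq_of_notMem _ _ _ hi]
      rwa [hu] at step
  simpa using key Finset.univ

/-- If every rule decreases the size of all its instances, rewriting terminates. -/
theorem terminating_of_tmSize_lt
    (h : ∀ l r (σ : Subst Sg ar), R l r → tmSize (subst σ r) < tmSize (subst σ l)) :
    Terminating R := by
  have dec : ∀ t u, Rew R t u → tmSize u < tmSize t := by
    intro t u htu
    induction htu with
    | root l r σ hlr => exact h l r σ hlr
    | congr s a b i _ hne ih =>
      simp only [tmSize, add_lt_add_iff_left]
      refine Finset.sum_lt_sum (fun j _ => ?_) ⟨i, Finset.mem_univ i, ih⟩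
      by_cases hj : j = i
      · exact hj ▸ ih.le
      · rw [hne j hj]
  exact Subrelation.wf (fun {u t} htu => dec t u htu) (measure tmSize).wf

theorem Terminating.exists_normalForm (h : Terminating R) (t : Tm Sg ar) :
    ∃ u, Reduces R t u ∧ NormalForm R u := by
  induction t using h.induction with
  | _ t ih =>
    by_cases ht : NormalForm R t
    · exact ⟨t, .refl, ht⟩
    · simp only [NormalForm, not_forall, not_not] at ht
      obtain ⟨v, hv⟩ := ht
      obtain ⟨u, hu, hn⟩ := ih v hv
      exact ⟨u, .head hv hu, hn⟩

theorem Reduces.eqTh {A : Tm Sg ar → Tm Sg ar → Prop}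
    (h : ∀ l r (σ : Subst Sg ar), R l r → EqTh A (subst σ l) (subst σ r))
    {t u : Tm Sg ar} (htu : Reduces R t u) : EqTh A t u := by
  have step : ∀ t u, Rew R t u → EqTh A t u := by
    intro t u htu
    induction htu with
    | root l r σ hlr => exact h l r σ hlr
    | congr s a b i _ hne ih =>
      refine EqTh.congr s a b fun j => ?_
      by_cases hj : j = i
      · exact hj ▸ ih
      · exact hne j hj ▸ EqTh.refl _
  induction htu with
  | refl => exact .refl _
  | tail _ hs ih => exact .trans ih (step _ _ hs)

end General

section Constructors

variable (σ : Subst SgD arD) (a b c : TmD)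

theorem subst_dSig : subst σ (dSig a b) = dSig (subst σ a) (subst σ b) := by
  simp only [dSig, subst]; congr 1; funext i; fin_cases i <;> rfl

theorem subst_dVer : subst σ (dVer a b c) = dVer (subst σ a) (subst σ b) (subst σ c) := by
  simp only [dVer, subst]; congr 1; funext i; fin_cases i <;> rfl

theorem subst_dSkp : subst σ (dSkp a b) = dSkp (subst σ a) (subst σ b) := by
  simp only [dSkp, subst]; congr 1; funext i; fin_cases i <;> rfl

theorem subst_dPkp : subst σ (dPkp a b) = dPkp (subst σ a) (subst σ b) := by
  simp only [dPkp, subst]; congr 1; funext i; fin_cases i <;> rfl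

theorem subst_dSk : subst σ (dSk a) = dSk (subst σ a) := by
  simp only [dSk, subst]; congr 1; funext i; fin_cases i; rfl

theorem subst_dPk : subst σ (dPk a) = dPk (subst σ a) := by
  simp only [dPk, subst]; congr 1; funext i; fin_cases i; rfl

theorem subst_dOne : subst σ dOne = dOne := by
  simp only [dOne, subst]; congr 1; funext i; exact i.elim0

theorem tmSize_dSig : tmSize (dSig a b) = 1 + (tmSize a + tmSize b) :=
  congrArg (1 + ·) (Fin.sum_univ_two (fun i => tmSize (![a, b] i)))

theorem tmSize_dVer : tmSize (dVer a b c) = 1 + (tmSize a + tmSize b + tmSize c) :=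
  congrArg (1 + ·) (Fin.sum_univ_three (fun i => tmSize (![a, b, c] i)))

theorem tmSize_dSkp : tmSize (dSkp a b) = 1 + (tmSize a + tmSize b) :=
  congrArg (1 + ·) (Fin.sum_univ_two (fun i => tmSize (![a, b] i)))

theorem tmSize_dSk : tmSize (dSk a) = 1 + tmSize a :=
  congrArg (1 + ·) (Fin.sum_univ_one (fun i => tmSize (![a] i)))

theorem tmSize_dOne : tmSize dOne = 1 :=
  congrArg (1 + ·) (Fin.sum_univ_zero (fun i => tmSize ((![] : Fin 0 → TmD) i)))

theorem dPk_inj {a b : TmD} : dPk a = dPk b ↔ a = b := by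
  refine ⟨fun h => ?_, fun h => h ▸ rfl⟩
  exact congrFun (eq_of_heq (Tm.app.inj h).2) (0 : Fin 1)

theorem dSkp_inj {a b c d : TmD} : dSkp a b = dSkp c d ↔ a = c ∧ b = d := by
  refine ⟨fun h => ?_, fun h => h.1 ▸ h.2 ▸ rfl⟩
  have hf := eq_of_heq (Tm.app.inj h).2
  exact ⟨congrFun hf (0 : Fin 2), congrFun hf (1 : Fin 2)⟩

theorem dSk_ne_dSkp : dSk a ≠ dSkp b c := by
  intro h
  exact SgD.noConfusion (Tm.app.inj h).1

theorem eq_vec_one (f : Fin 1 → TmD) : f = ![f 0] := by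
  funext i; fin_cases i; rfl

theorem eq_vec_two (f : Fin 2 → TmD) : f = ![f 0, f 1] := by
  funext i; fin_cases i <;> rfl

theorem eq_vec_three (f : Fin 3 → TmD) : f = ![f 0, f 1, f 2] := by
  funext i; fin_cases i <;> rfl

theorem EqTh.dVer {A : TmD → TmD → Prop} {a b c a' b' c' : TmD}
    (h₀ : EqTh A a a') (h₁ : EqTh A b b') (h₂ : EqTh A c c') :
    EqTh A (dVer a b c) (dVer a' b' c') :=
  .congr (ar := arD) SgD.ver ![a, b, c] ![a', b', c'] fun i : Fin 3 =>
    match i with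
    | 0 => h₀
    | 1 => h₁
    | 2 => h₂

end Constructors

/-- The substitution sending the variables used by the rules to given terms. -/
def ruleSubst (x y z : TmD) : Subst SgD arD
  | 0 => x
  | 1 => y
  | _ => z

section Instances

theorem RDSKS_tmSize_lt (l r : TmD) (σ : Subst SgD arD) (h : RDSKS l r) :
    tmSize (subst σ r) < tmSize (subst σ l) := by
  cases h <;>
    simp only [subst_dSig, subst_dVer, subst_dSkp, subst_dSk, subst_dOne,
      tmSize_dSig, tmSize_dVer, tmSize_dSkp, tmSize_dSk, tmSize_dOne] <;> omega

theorem eqTh_ver_skp (x y₁ y₂ : TmD) :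
    EqTh ADSKS (dVer x (dSig x (dSkp y₁ y₂)) (dPkp y₁ y₂)) dOne := by
  have h := EqTh.ax _ _ (ruleSubst x y₁ y₂) ADSKS.a2
  simpa only [subst_dSig, subst_dVer, subst_dSkp, subst_dPkp, subst_dOne, xD, y1D, y2D, subst,
    ruleSubst] using h

theorem eqTh_sig_skp (x y : TmD) :
    EqTh ADSKS (dSig x (dSkp (dPk y) (dSig x (dSk y)))) (dSig x (dSk y)) := by
  have h := EqTh.ax _ _ (ruleSubst x y y) ADSKS.a3
  simpa only [subst_dSig, subst_dSkp, subst_dSk, subst_dPk, xD, yD, subst, ruleSubst] using h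

theorem RDSKS_eqTh (l r : TmD) (σ : Subst SgD arD) (h : RDSKS l r) :
    EqTh ADSKS (subst σ l) (subst σ r) := by
  cases h with
  | r1 => exact .ax _ _ σ .a1
  | r2 => exact .ax _ _ σ .a2
  | r4 => exact .ax _ _ σ .a3
  | r3 =>
    simp only [subst_dSig, subst_dVer, subst_dPkp, subst_dSk, subst_dPk, subst_dOne]
    exact .trans (.dVer (.refl _) (.symm (eqTh_sig_skp _ _)) (.refl _)) (eqTh_ver_skp _ _ _)

theorem reduces_ver_sk (x y : TmD) :
    Reduces RDSKS (dVer x (dSig x (dSk y)) (dPk y)) dOne := by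
  have h := Rew.root _ _ (ruleSubst x y y) RDSKS.r1
  simp only [subst_dSig, subst_dVer, subst_dSk, subst_dPk, subst_dOne, xD, yD, subst,
    ruleSubst] at h
  exact .single h

theorem reduces_ver_skp (x y₁ y₂ : TmD) :
    Reduces RDSKS (dVer x (dSig x (dSkp y₁ y₂)) (dPkp y₁ y₂)) dOne := by
  have h := Rew.root _ _ (ruleSubst x y₁ y₂) RDSKS.r2
  simp only [subst_dSig, subst_dVer, subst_dSkp, subst_dPkp, subst_dOne, xD, y1D, y2D, subst,
    ruleSubst] at h
  exact .single h

theorem reduces_ver_pkp (x y : TmD) :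
    Reduces RDSKS (dVer x (dSig x (dSk y)) (dPkp (dPk y) (dSig x (dSk y)))) dOne := by
  have h := Rew.root _ _ (ruleSubst x y y) RDSKS.r3
  simp only [subst_dSig, subst_dVer, subst_dSk, subst_dPk, subst_dPkp, subst_dOne, xD, yD, subst,
    ruleSubst] at h
  exact .single h

theorem reduces_sig_skp (x y : TmD) :
    Reduces RDSKS (dSig x (dSkp (dPk y) (dSig x (dSk y)))) (dSig x (dSk y)) := by
  have h := Rew.root _ _ (ruleSubst x y y) RDSKS.r4
  simp only [subst_dSig, subst_dSkp, subst_dSk, subst_dPk, xD, yD, subst, ruleSubst] at h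
  exact .single h

end Instances

/-- `Ver(a, b, c)` is an instance of the left-hand side of a rule. -/
def VerRedex (a b c : TmD) : Prop :=
  (∃ y, b = dSig a (dSk y) ∧ c = dPk y) ∨
  (∃ y₁ y₂, b = dSig a (dSkp y₁ y₂) ∧ c = dPkp y₁ y₂) ∨
  (∃ y, b = dSig a (dSk y) ∧ c = dPkp (dPk y) (dSig a (dSk y)))

open Classical in
/-- Contraction of `Ver(a, b, c)` at the root. -/
noncomputable def contractVer (a b c : TmD) : TmD :=
  if VerRedex a b c then dOne else dVer a b c

open Classical in
/-- Contraction of `Sig(a, b)` at the root. -/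
noncomputable def contractSig (a b : TmD) : TmD :=
  if h : ∃ y, b = dSkp (dPk y) (dSig a (dSk y)) then dSig a (dSk h.choose) else dSig a b

/-- Contraction of a term at the root. -/
noncomputable def contract : (s : SgD) → (Fin (arD s) → TmD) → TmD
  | .sig, f => contractSig (f (0 : Fin 2)) (f (1 : Fin 2))
  | .ver, f => contractVer (f (0 : Fin 3)) (f (1 : Fin 3)) (f (2 : Fin 3))
  | s, f => .app s f

/-- Bottom-up normalization for `RDSKS`. -/
noncomputable def normalize : TmD → TmD
  | .var n => .var n
  | .cst c => .cst c
  | .app s a => contract s fun i => normalize (a i)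

theorem contractSig_skp (x y : TmD) :
    contractSig x (dSkp (dPk y) (dSig x (dSk y))) = dSig x (dSk y) := by
  have h : ∃ z, dSkp (dPk y) (dSig x (dSk y)) = dSkp (dPk z) (dSig x (dSk z)) := ⟨y, rfl⟩
  have hy : y = h.choose := dPk_inj.1 (dSkp_inj.1 h.choose_spec).1
  rw [contractSig, dif_pos h, ← hy]

theorem contractSig_sk (x y : TmD) : contractSig x (dSk y) = dSig x (dSk y) :=
  dif_neg fun ⟨_, h⟩ => dSk_ne_dSkp _ _ _ h

theorem contractVer_sk (x y : TmD) : contractVer x (dSig x (dSk y)) (dPk y) = dOne :=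
  if_pos (.inl ⟨y, rfl, rfl⟩)

theorem contractVer_pkp (x y : TmD) :
    contractVer x (dSig x (dSk y)) (dPkp (dPk y) (dSig x (dSk y))) = dOne :=
  if_pos (.inr (.inr ⟨y, rfl, rfl⟩))

theorem contractVer_skp (x y₁ y₂ : TmD) :
    contractVer x (contractSig x (dSkp y₁ y₂)) (dPkp y₁ y₂) = dOne := by
  by_cases h : ∃ y, dSkp y₁ y₂ = dSkp (dPk y) (dSig x (dSk y))
  · obtain ⟨y, hy⟩ := h
    obtain ⟨rfl, rfl⟩ := dSkp_inj.1 hy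
    rw [contractSig_skp, contractVer_pkp]
  · rw [contractSig, dif_neg h]
    exact if_pos (.inr (.inl ⟨y₁, y₂, rfl, rfl⟩))

theorem reduces_contractSig (a b : TmD) : Reduces RDSKS (dSig a b) (contractSig a b) := by
  by_cases h : ∃ y, b = dSkp (dPk y) (dSig a (dSk y))
  · obtain ⟨y, rfl⟩ := h
    rw [contractSig_skp]
    exact reduces_sig_skp a y
  · rw [contractSig, dif_neg h]
    exact .refl

theorem reduces_contractVer (a b c : TmD) :
    Reduces RDSKS (dVer a b c) (contractVer a b c) := by
  by_cases h : VerRedex a b c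
  · rw [contractVer, if_pos h]
    rcases h with ⟨y, rfl, rfl⟩ | ⟨y₁, y₂, rfl, rfl⟩ | ⟨y, rfl, rfl⟩
    · exact reduces_ver_sk a y
    · exact reduces_ver_skp a y₁ y₂
    · exact reduces_ver_pkp a y
  · rw [contractVer, if_neg h]
    exact .refl

theorem reduces_contract (s : SgD) (f : Fin (arD s) → TmD) :
    Reduces RDSKS (.app s f) (contract s f) := by
  cases s with
  | sig =>
    have h := reduces_contractSig (f (0 : Fin 2)) (f (1 : Fin 2))
    rw [dSig, ← eq_vec_two f] at h
    exact h
  | ver =>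
    have h := reduces_contractVer (f (0 : Fin 3)) (f (1 : Fin 3)) (f (2 : Fin 3))
    rw [dVer, ← eq_vec_three f] at h
    exact h
  | _ => exact .refl

theorem reduces_normalize (t : TmD) : Reduces RDSKS t (normalize t) := by
  induction t with
  | var n => exact .refl
  | cst c => exact .refl
  | app s a ih => exact .trans (Reduces.app s ih) (reduces_contract s _)

section NormalizeConstructors

variable (a b c : TmD)

theorem normalize_dSig : normalize (dSig a b) = contractSig (normalize a) (normalize b) := rfl

theorem normalize_dVer :
    normalize (dVer a b c) = contractVer (normalize a) (normalize b) (normalize c) := rfl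

theorem normalize_dSkp : normalize (dSkp a b) = dSkp (normalize a) (normalize b) :=
  congrArg (Tm.app SgD.skp) (eq_vec_two _)

theorem normalize_dPkp : normalize (dPkp a b) = dPkp (normalize a) (normalize b) :=
  congrArg (Tm.app SgD.pkp) (eq_vec_two _)

theorem normalize_dSk : normalize (dSk a) = dSk (normalize a) :=
  congrArg (Tm.app SgD.sk) (eq_vec_one _)

theorem normalize_dPk : normalize (dPk a) = dPk (normalize a) :=
  congrArg (Tm.app SgD.pk) (eq_vec_one _)

theorem normalize_dOne : normalize dOne = dOne :=
  congrArg (Tm.app SgD.one) (funext fun i : Fin 0 => i.elim0)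

end NormalizeConstructors

theorem normalize_eq_of_eqTh {s t : TmD} (h : EqTh ADSKS s t) : normalize s = normalize t := by
  induction h with
  | ax l r σ h =>
    cases h <;>
      simp only [subst_dSig, subst_dVer, subst_dSkp, subst_dPkp, subst_dSk, subst_dPk, subst_dOne,
        normalize_dSig, normalize_dVer, normalize_dSkp, normalize_dPkp, normalize_dSk,
        normalize_dPk, normalize_dOne, contractSig_sk, contractSig_skp, contractVer_sk,
        contractVer_skp]
  | refl => rfl
  | symm _ ih => exact ih.symm
  | trans _ _ ih₁ ih₂ => exact ih₁.trans ih₂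
  | congr s a b _ ih => simp only [normalize, ih]

theorem RDSKS_confluent : Confluent RDSKS := by
  intro a b c hb hc
  have h : EqTh ADSKS b c := .trans (.symm (hb.eqTh RDSKS_eqTh)) (hc.eqTh RDSKS_eqTh)
  exact ⟨normalize b, reduces_normalize b, normalize_eq_of_eqTh h ▸ reduces_normalize c⟩

/-- the rewrite system R_DSKS is convergent (terminating and
confluent) and generates the equational theory H_DSKS: two terms are equal
modulo H_DSKS if and only if they have the same R_DSKS-normal form. -/
theorem RDSKS_convergent_and_generates_HDSKS :
    Convergent RDSKS ∧
    ∀ s t : TmD, EqTh ADSKS s t ↔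
      ∃ u, Reduces RDSKS s u ∧ Reduces RDSKS t u ∧ NormalForm RDSKS u := by
  have hterm : Terminating RDSKS := terminating_of_tmSize_lt RDSKS_tmSize_lt
  refine ⟨⟨hterm, RDSKS_confluent⟩, fun s t => ⟨fun h => ?_, ?_⟩⟩
  · obtain ⟨u, hu, hn⟩ := hterm.exists_normalForm (normalize s)
    exact ⟨u, (reduces_normalize s).trans hu,
      (reduces_normalize t).trans (normalize_eq_of_eqTh h ▸ hu), hn⟩
  · rintro ⟨u, hs, ht, -⟩
    exact .trans (hs.eqTh RDSKS_eqTh) (.symm (ht.eqTh RDSKS_eqTh))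

end Paper
end

section
/- Let (I, I') be either (I_DSKS, I'_DSKS) or (I_DEO, I'_DEO). For any finite set E of ground terms in normal form and any ground term t in normal form: t is derivable from E in the intruder system I (E ↠*_I … with goal t) if and only if t is derivable from E in the saturated intruder system I'. -/
set_option maxHeartbeats 1000000

namespace Paper

lemma DedStep.mono {L L' : Set (Rule Sg ar)} {A : Tm Sg ar → Tm Sg ar → Prop}
    (h : L ⊆ L') {E F : Set (Tm Sg ar)} : DedStep L A E F → DedStep L' A E F :=
  fun ⟨l, r, σ, r', hl, hs⟩ => ⟨l, r, σ, r', h hl, hs⟩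

lemma deriv_iff_of_subset {L L' : Set (Rule Sg ar)} {A : Tm Sg ar → Tm Sg ar → Prop}
    (h : L ⊆ L') (h' : ∀ E F, DedStep L' A E F → DedStep L A E F)
    (E : Set (Tm Sg ar)) (t : Tm Sg ar) : Deriv L A E t ↔ Deriv L' A E t :=
  ⟨fun ⟨F, hF, ht⟩ => ⟨F, Relation.ReflTransGen.mono (fun _ _ => DedStep.mono h) _ _ hF, ht⟩,
    fun ⟨F, hF, ht⟩ => ⟨F, Relation.ReflTransGen.mono h' _ _ hF, ht⟩⟩

lemma subst_dSig_s8 (σ : Subst SgD arD) (u v : TmD) :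
    subst σ (dSig u v) = dSig (subst σ u) (subst σ v) := by
  refine congrArg (Tm.app SgD.sig) (funext fun i => ?_)
  change Fin 2 at i
  fin_cases i <;> rfl

/-- Signing with deducible arguments is a deduction step, up to the equational theory. -/
lemma dedStep_DSKS_sig {E : Set TmD} {u v u' v' r : TmD}
    (hu : u' ∈ E) (hv : v' ∈ E) (huu : EqTh ADSKS u u') (hvv : EqTh ADSKS v v')
    (hr : EqTh ADSKS (dSig u v) r) : DedStep LDSKS ADSKS E (E ∪ {r}) := by
  refine ⟨{xD, yD}, dSig xD yD, fun n => if n = 0 then u else v, r,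
    by simp [LDSKS], ?_, ?_, rfl⟩
  · rintro w (rfl | rfl)
    · exact ⟨u', hu, huu⟩
    · exact ⟨v', hv, hvv⟩
  · rw [subst_dSig_s8]
    exact hr

lemma dedStep_DSKS_of_saturated (E F : Set TmD) (h : DedStep LDSKS' ADSKS E F) :
    DedStep LDSKS ADSKS E F := by
  obtain ⟨l, r, σ, r', hl, hE, hr, rfl⟩ := h
  rcases hl with hl | hl | hl
  · exact ⟨l, r, σ, r', hl, hE, hr, rfl⟩
  all_goals
    obtain ⟨rfl, rfl⟩ := Prod.mk.inj hl
    obtain ⟨u', hu, huu⟩ := hE _ (Or.inl rfl)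
    obtain ⟨v', hv, hvv⟩ := hE _ (Or.inr rfl)
    refine dedStep_DSKS_sig hu hv huu hvv ?_
    rw [← subst_dSig_s8]
  · exact hr
  · exact (EqTh.ax _ _ σ .a3).trans hr

lemma subst_eSig (σ : Subst SgE arE) (u v : TmE) :
    subst σ (eSig u v) = eSig (subst σ u) (subst σ v) := by
  refine congrArg (Tm.app SgE.sig) (funext fun i => ?_)
  change Fin 2 at i
  fin_cases i <;> rfl

/-- Signing with deducible arguments is a deduction step, up to the equational theory. -/
lemma dedStep_DEO_sig {E : Set TmE} {u v u' v' r : TmE}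
    (hu : u' ∈ E) (hv : v' ∈ E) (huu : EqTh ADEO u u') (hvv : EqTh ADEO v v')
    (hr : EqTh ADEO (eSig u v) r) : DedStep LDEO ADEO E (E ∪ {r}) := by
  refine ⟨{xE, yE}, eSig xE yE, fun n => if n = 0 then u else v, r,
    by simp [LDEO], ?_, ?_, rfl⟩
  · rintro w (rfl | rfl)
    · exact ⟨u', hu, huu⟩
    · exact ⟨v', hv, hvv⟩
  · rw [subst_eSig]
    exact hr

lemma dedStep_DEO_of_saturated (E F : Set TmE) (h : DedStep LDEO' ADEO E F) :
    DedStep LDEO ADEO E F := by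
  obtain ⟨l, r, σ, r', hl, hE, hr, rfl⟩ := h
  rcases hl with hl | hl
  · exact ⟨l, r, σ, r', hl, hE, hr, rfl⟩
  obtain ⟨rfl, rfl⟩ := Prod.mk.inj hl
  obtain ⟨u', hu, huu⟩ := hE _ (Or.inl rfl)
  obtain ⟨v', hv, hvv⟩ := hE _ (Or.inr rfl)
  refine dedStep_DEO_sig hu hv huu hvv ?_
  rw [← subst_eSig]
  exact (EqTh.ax _ _ σ .a3).trans hr

/-- for any finite set `E` of ground terms in normal form and any
ground term `t` in normal form, `t` is derivable from `E` in the intruder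
system I_DSKS (resp. I_DEO) iff it is derivable in the saturated intruder
system I'_DSKS (resp. I'_DEO). -/
theorem saturated_system_same_deductive_power :
    (∀ (E : Set TmD) (t : TmD), E.Finite →
       (∀ u ∈ E, Ground u ∧ NormalForm RDSKS u) →
       Ground t → NormalForm RDSKS t →
       (Deriv LDSKS ADSKS E t ↔ Deriv LDSKS' ADSKS E t)) ∧
    (∀ (E : Set TmE) (t : TmE), E.Finite →
       (∀ u ∈ E, Ground u ∧ NormalForm RDEO u) →
       Ground t → NormalForm RDEO t →
       (Deriv LDEO ADEO E t ↔ Deriv LDEO' ADEO E t)) := by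
  exact ⟨fun E t _ _ _ _ =>
      deriv_iff_of_subset Set.subset_union_left dedStep_DSKS_of_saturated E t,
    fun E t _ _ _ _ =>
      deriv_iff_of_subset Set.subset_union_left dedStep_DEO_of_saturated E t⟩

end Paper
end
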